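/- arXiv:0812.1374 — 2 statements merged into one kernel-verified Lean document; each statement's English description precedes it below -/
import Mathlib

section
/- For a primitive Dirichlet character χ modulo q ≥ 3 and any integer r ≥ 1, and arbitrary X > 0, (-1)^r L^{(r)}(1,χ) = ∑_{n ≤ X} χ(n)(log n)^r/n + ∑_{a=1}^q χ(a)·[ ψ((X-a)/q)·(log X)^r/X + (1/q)∫_{X/q}^∞ ψ(u - a/q)·(log qu)^{r-1}·(r - log qu)/u² du ], where ψ(u) = u - ⌊u⌋ - 1/2. -/
open Complex MeasureTheory

/-- The sawtooth function `ψ(u) = u - ⌊u⌋ - 1/2`. -/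
noncomputable def saw (u : ℝ) : ℝ := u - ⌊u⌋ - 1/2

lemma abs_saw_le (u : ℝ) : |saw u| ≤ 1 / 2 := by
  have h₁ := Int.floor_le u
  have h₂ := Int.lt_floor_add_one u
  rw [saw, abs_le]
  constructor <;> linarith

lemma measurable_saw : Measurable saw := by
  unfold saw
  fun_prop

namespace DirichletCharacter

open Filter Topology Asymptotics

variable {q : ℕ} (χ : DirichletCharacter ℂ q)

/-- The partial sum `∑_{k ≤ t} χ(k)`. -/
noncomputable def partialSum (t : ℝ) : ℂ := ∑ k ∈ Finset.Icc 0 ⌊t⌋₊, χ (k : ZMod q)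

/-- The periodic function `∑_{a=1}^q χ(a) ψ((t-a)/q)`. -/
noncomputable def sawSum (t : ℝ) : ℂ :=
  ∑ a ∈ Finset.Icc 1 q, χ (a : ZMod q) * (saw ((t - a) / q) : ℂ)

lemma ne_one_of_isPrimitive [NeZero q] (hq : 3 ≤ q) {χ : DirichletCharacter ℂ q}
    (hχ : χ.IsPrimitive) :
    χ ≠ 1 := by
  rintro rfl
  rw [isPrimitive_def, conductor_one] at hχ
  omega

lemma apply_zero_of_ne_one {χ : DirichletCharacter ℂ q} (hχ : χ ≠ 1) : χ (0 : ZMod q) = 0 := by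
  refine χ.map_nonunit fun h ↦ hχ ?_
  have : Subsingleton (ZMod q) := subsingleton_of_zero_eq_one (isUnit_zero_iff.mp h)
  have : Subsingleton (ZMod q)ˣ := inferInstance
  ext a
  rw [Subsingleton.elim a 1]
  simp

lemma sum_Icc_one_eq_sum [NeZero q] (f : ZMod q → ℂ) :
    ∑ a ∈ Finset.Icc 1 q, f (a : ZMod q) = ∑ a : ZMod q, f a := by
  refine Finset.sum_bij' (fun a _ ↦ (a : ZMod q))
    (fun b _ ↦ if b = 0 then q else b.val) (by simp) ?_ ?_ ?_ (by simp)
  · intro b _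
    have := b.val_lt
    have h := NeZero.pos q
    split_ifs with hb
    · simp; omega
    · have := (ZMod.val_ne_zero b).mpr hb
      simp; omega
  · intro a ha
    rw [Finset.mem_Icc] at ha
    rcases ha.2.lt_or_eq with h | rfl
    · have : (a : ZMod q) ≠ 0 := by
        rw [Ne, ZMod.natCast_eq_zero_iff]
        exact Nat.not_dvd_of_pos_of_lt (by omega) h
      simp [this, ZMod.val_natCast_of_lt h]
    · simp
  · intro b _
    split_ifs with hb <;> simp [hb]

lemma sum_Icc_one_apply_mul_ite [NeZero q] (m : ℤ) :
    ∑ a ∈ Finset.Icc 1 q, χ (a : ZMod q) * (if (q : ℤ) ∣ m - a then 1 else 0) = χ (m : ZMod q) := by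
  have h (a : ℕ) : (q : ℤ) ∣ m - a ↔ (m : ZMod q) = (a : ZMod q) := by
    rw [← ZMod.intCast_zmod_eq_zero_iff_dvd]
    push_cast
    exact sub_eq_zero
  simp_rw [h]
  rw [sum_Icc_one_eq_sum (fun x ↦ χ x * (if (m : ZMod q) = x then 1 else 0))]
  simp

lemma succ_ediv_natCast [NeZero q] (m : ℤ) :
    (m + 1) / (q : ℤ) = m / q + if (q : ℤ) ∣ m + 1 then 1 else 0 := by
  have hq : (0 : ℤ) < q := mod_cast NeZero.pos q
  split_ifs with h
  · obtain ⟨k, hk⟩ := h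
    rw [hk, Int.mul_ediv_cancel_left _ hq.ne']
    have : m / q = k - 1 := by
      rw [Int.ediv_eq_iff_of_pos hq]
      constructor <;> nlinarith
    omega
  · rw [add_zero, Int.ediv_eq_iff_of_pos hq]
    have h₁ := Int.emod_add_mul_ediv m q
    have h₂ := Int.emod_nonneg m hq.ne'
    have h₃ := Int.emod_lt_of_pos m hq
    refine ⟨by linarith [mul_comm (m / q) (q : ℤ)], ?_⟩
    by_contra! h₄
    exact h ⟨m / q + 1, by linarith [mul_comm (m / q) (q : ℤ)]⟩

lemma partialSum_add_sawSum [NeZero q] {χ : DirichletCharacter ℂ q} (hχ : χ ≠ 1)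
    {t : ℝ} (ht : 0 ≤ t) :
    χ.partialSum t + χ.sawSum t = χ.sawSum 0 := by
  have hq : (q : ℝ) ≠ 0 := mod_cast NeZero.ne q
  have hsum : ∑ a ∈ Finset.Icc 1 q, χ (a : ZMod q) = 0 := by
    rw [sum_Icc_one_eq_sum (fun x ↦ χ x), χ.sum_eq_zero_of_ne_one hχ]
  have hsaw (t : ℝ) (ht : 0 ≤ t) : χ.sawSum t = χ.sawSum 0 +
      ∑ a ∈ Finset.Icc 1 q, χ (a : ZMod q) * (((0 - a : ℤ) / (q : ℤ) : ℤ) : ℂ) -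
      ∑ a ∈ Finset.Icc 1 q, χ (a : ZMod q) * ((((⌊t⌋₊ : ℤ) - a : ℤ) / (q : ℤ) : ℤ) : ℂ) := by
    have hfl (t : ℝ) (ht : 0 ≤ t) (a : ℕ) : ⌊(t - a) / q⌋ = ((⌊t⌋₊ : ℤ) - a) / (q : ℤ) := by
      rw [Int.floor_div_natCast, Int.floor_sub_natCast, Int.natCast_floor_eq_floor ht]
    have hdiff : χ.sawSum t - χ.sawSum 0 = (t / q : ℂ) * ∑ a ∈ Finset.Icc 1 q, χ (a : ZMod q) +
        (∑ a ∈ Finset.Icc 1 q, χ (a : ZMod q) * (((0 - a : ℤ) / (q : ℤ) : ℤ) : ℂ) -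
        ∑ a ∈ Finset.Icc 1 q, χ (a : ZMod q) * ((((⌊t⌋₊ : ℤ) - a : ℤ) / (q : ℤ) : ℤ) : ℂ)) := by
      simp_rw [sawSum, Finset.mul_sum, ← Finset.sum_sub_distrib, ← Finset.sum_add_distrib]
      refine Finset.sum_congr rfl fun a _ ↦ ?_
      rw [saw, saw, hfl t ht, hfl 0 le_rfl, Nat.floor_zero]
      push_cast
      ring
    rw [hsum, mul_zero, zero_add] at hdiff
    linear_combination hdiff
  have hpart (N : ℕ) : ∑ k ∈ Finset.Icc 0 N, χ (k : ZMod q) =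
      ∑ a ∈ Finset.Icc 1 q, χ (a : ZMod q) * ((((N : ℤ) - a : ℤ) / (q : ℤ) : ℤ) : ℂ) -
      ∑ a ∈ Finset.Icc 1 q, χ (a : ZMod q) * (((0 - a : ℤ) / (q : ℤ) : ℤ) : ℂ) := by
    induction N with
    | zero => simp [apply_zero_of_ne_one hχ]
    | succ N ih =>
      have key := χ.sum_Icc_one_apply_mul_ite (N + 1)
      rw [Finset.sum_Icc_succ_top (Nat.zero_le _), ih, sub_add_eq_add_sub]
      congr 1
      have : χ ((N + 1 : ℕ) : ZMod q) = χ (((N : ℤ) + 1 : ℤ) : ZMod q) := by push_cast; rfl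
      rw [this, ← key, ← Finset.sum_add_distrib]
      refine Finset.sum_congr rfl fun a _ ↦ ?_
      rw [← mul_add, show (((N + 1 : ℕ) : ℤ) - a) = ((N : ℤ) - a) + 1 by push_cast; ring,
        succ_ediv_natCast, show (N : ℤ) + 1 - a = (N : ℤ) - a + 1 by ring]
      push_cast
      rfl
  rw [partialSum, hpart, hsaw t ht]
  ring

lemma norm_sawSum_le (t : ℝ) : ‖χ.sawSum t‖ ≤ q := by
  refine (norm_sum_le _ _).trans ?_
  refine (Finset.sum_le_card_nsmul _ _ 1 fun a _ ↦ ?_).trans (by simp)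
  rw [norm_mul, norm_real, Real.norm_eq_abs]
  have h₁ := χ.norm_le_one (a : ZMod q)
  have h₂ := abs_saw_le ((t - a) / q)
  nlinarith [norm_nonneg (χ (a : ZMod q)), abs_nonneg (saw ((t - a) / q))]

lemma measurable_sawSum : Measurable χ.sawSum := by
  refine Finset.measurable_sum _ fun a _ ↦ measurable_const.mul ?_
  exact measurable_ofReal.comp (measurable_saw.comp (by fun_prop))

lemma partialSum_of_lt_one {χ : DirichletCharacter ℂ q} (hχ : χ ≠ 1) {t : ℝ} (ht : t < 1) :
    χ.partialSum t = 0 := by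
  simp [partialSum, Nat.floor_eq_zero.mpr ht, apply_zero_of_ne_one hχ]

lemma norm_partialSum_le [NeZero q] {χ : DirichletCharacter ℂ q} (hχ : χ ≠ 1) (t : ℝ) :
    ‖χ.partialSum t‖ ≤ 2 * q := by
  rcases lt_or_ge t 1 with ht | ht
  · simp [partialSum_of_lt_one hχ ht]
  replace ht := zero_le_one.trans ht
  rw [eq_sub_of_add_eq (partialSum_add_sawSum hχ ht), two_mul]
  exact (norm_sub_le _ _).trans (add_le_add (χ.norm_sawSum_le _) (χ.norm_sawSum_le _))

lemma measurable_partialSum : Measurable χ.partialSum :=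
  (measurable_from_nat (f := fun n ↦ ∑ k ∈ Finset.Icc 0 n, χ (k : ZMod q))).comp
    Nat.measurable_floor

lemma log_pow_isBigO_rpow (k : ℕ) {ε : ℝ} (hε : 0 < ε) :
    (fun t : ℝ ↦ Real.log t ^ k) =O[atTop] (fun t ↦ t ^ ε) := by
  have := (isLittleO_log_rpow_rpow_atTop k hε).isBigO
  simpa using this

/-- The Mellin transform of `t ↦ (log t)^k ∑_{n ≤ t} χ(n)`. -/
noncomputable def logMellin (k : ℕ) (w : ℂ) : ℂ :=
  mellin (fun t ↦ (Real.log t : ℂ) ^ k * χ.partialSum t) w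

lemma mellinConvergent_and_hasDerivAt_logMellin [NeZero q] {χ : DirichletCharacter ℂ q} (hχ : χ ≠ 1)
    (k : ℕ) {w : ℂ} (hw : w.re < 0) :
    MellinConvergent (fun t ↦ (Real.log t : ℂ) ^ k * χ.partialSum t) w ∧
      HasDerivAt (χ.logMellin k) (χ.logMellin (k + 1) w) w := by
  have hloc : LocallyIntegrableOn (fun t ↦ (Real.log t : ℂ) ^ k * χ.partialSum t) (Set.Ioi 0) := by
    have hA : LocallyIntegrableOn χ.partialSum (Set.Ioi 0) :=
      LocallyIntegrableOn.mono (f := fun _ ↦ (2 * q : ℝ))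
        ((locallyIntegrable_const _).locallyIntegrableOn _)
        χ.measurable_partialSum.aestronglyMeasurable
        (.of_forall fun t ↦ (norm_partialSum_le hχ t).trans (Real.le_norm_self _))
    refine hA.continuousOn_mul (fun t ht ↦ ?_) isOpen_Ioi.isLocallyClosed
    exact ((continuous_ofReal.continuousAt.comp
      (Real.continuousAt_log (ne_of_gt ht))).pow k).continuousWithinAt
  have htop : (fun t ↦ (Real.log t : ℂ) ^ k * χ.partialSum t) =O[atTop]
      (fun t : ℝ ↦ t ^ (-(w.re / 2))) := by
    have h₁ : (fun t : ℝ ↦ (Real.log t : ℂ) ^ k) =O[atTop] (fun t : ℝ ↦ t ^ (-(w.re / 2))) := by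
      refine IsBigO.of_norm_left ?_
      simpa using (log_pow_isBigO_rpow k (show 0 < -(w.re / 2) by linarith)).norm_left
    have h₂ : χ.partialSum =O[atTop] (fun _ ↦ (1 : ℝ)) := by
      refine IsBigO.of_bound (2 * q) (.of_forall fun t ↦ ?_)
      simpa using norm_partialSum_le hχ t
    simpa using h₁.mul h₂
  have hbot : (fun t ↦ (Real.log t : ℂ) ^ k * χ.partialSum t) =O[𝓝[>] 0]
      (fun t : ℝ ↦ t ^ (-(w.re - 1))) := by
    refine EventuallyEq.trans_isBigO (f₂ := fun _ ↦ (0 : ℂ)) ?_ (isBigO_zero _ _)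
    filter_upwards [nhdsWithin_le_nhds (eventually_lt_nhds (zero_lt_one (α := ℝ)))] with t ht
    simp [partialSum_of_lt_one hχ ht]
  refine ⟨mellinConvergent_of_isBigO_rpow hloc htop (by linarith) hbot (by linarith), ?_⟩
  convert! (mellin_hasDerivAt_of_isBigO_rpow hloc htop (s := w) (by linarith) hbot
    (by linarith)).2 using 1
  rw [logMellin]
  congr 1
  ext t
  rw [real_smul]
  ring

lemma LFunction_eq_mul_logMellin [NeZero q] {χ : DirichletCharacter ℂ q} (hχ : χ ≠ 1) {s : ℂ}
    (hs : 0 < s.re) : LFunction χ s = s * χ.logMellin 0 (-s) := by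
  have hopen : IsOpen {s : ℂ | 0 < s.re} := isOpen_lt continuous_const continuous_re
  refine AnalyticOnNhd.eqOn_of_preconnected_of_eventuallyEq (𝕜 := ℂ) (U := {s : ℂ | 0 < s.re})
    (f := LFunction χ) (g := fun s ↦ s * χ.logMellin 0 (-s)) (z₀ := 2)
    ((differentiable_LFunction hχ).differentiableOn.analyticOnNhd hopen) ?_
    (convex_halfSpace_re_gt 0).isPreconnected (by simp) ?_ hs
  · refine DifferentiableOn.analyticOnNhd (fun s hs ↦ ?_) hopen
    have := (mellinConvergent_and_hasDerivAt_logMellin hχ 0 (w := -s) (by simpa using hs)).2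
    exact (differentiableAt_id.mul
      (this.differentiableAt.comp s differentiableAt_id.neg)).differentiableWithinAt
  · filter_upwards [(isOpen_lt continuous_const continuous_re).mem_nhds
      (show (1 : ℝ) < (2 : ℂ).re by simp)] with s hs
    have hIcc (n : ℕ) : ∑ k ∈ Finset.Icc 1 n, χ (k : ZMod q) =
        ∑ k ∈ Finset.Icc 0 n, χ (k : ZMod q) := by
      rw [← Finset.add_sum_Ioc_eq_sum_Icc (Nat.zero_le n), Nat.cast_zero, apply_zero_of_ne_one hχ,
        zero_add]
      rfl
    have hs' : (1 : ℝ) < s.re := hs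
    rw [LFunction_eq_LSeries χ hs, LSeries_eq_mul_integral _ le_rfl (zero_lt_one.trans hs')
      (χ.LSeriesSummable_of_one_lt_re hs), logMellin, mellin]
    · congr 1
      symm
      simp_rw [← integral_Ici_eq_integral_Ioi (x := (1 : ℝ))]
      refine setIntegral_eq_of_subset_of_forall_sdiff_eq_zero measurableSet_Ioi
        (fun t ht ↦ zero_lt_one.trans_le ht) (fun t ht ↦ ?_) |>.trans ?_
      · simp [partialSum_of_lt_one hχ (not_le.mp ht.2)]
      · refine setIntegral_congr_fun measurableSet_Ici fun t _ ↦ ?_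
        simp only [pow_zero, one_mul, smul_eq_mul, hIcc, partialSum]
        rw [mul_comm]
        congr 2
        ring
    · refine IsBigO.of_bound (2 * q) (Eventually.of_forall fun n ↦ ?_)
      have := norm_partialSum_le hχ n
      rw [partialSum, Nat.floor_natCast] at this
      simpa [hIcc] using this

lemma iteratedDeriv_LFunction_eq [NeZero q] {χ : DirichletCharacter ℂ q} (hχ : χ ≠ 1)
    (r : ℕ) {s : ℂ} (hs : 0 < s.re) : iteratedDeriv r (LFunction χ) s =
      (-1) ^ r * (s * χ.logMellin r (-s) - r * χ.logMellin (r - 1) (-s)) := by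
  have hderiv (k : ℕ) {s : ℂ} (hs : 0 < s.re) :
      HasDerivAt (fun s ↦ χ.logMellin k (-s)) (-χ.logMellin (k + 1) (-s)) s := by
    have := (mellinConvergent_and_hasDerivAt_logMellin hχ k (w := -s) (by simpa using hs)).2
    simpa [Function.comp_def] using this.comp s (hasDerivAt_neg s)
  induction r generalizing s with
  | zero => simp [LFunction_eq_mul_logMellin hχ hs]
  | succ r ih =>
    have hev : iteratedDeriv r (LFunction χ) =ᶠ[𝓝 s] fun s ↦
        (-1) ^ r * (s * χ.logMellin r (-s) - r * χ.logMellin (r - 1) (-s)) := by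
      filter_upwards [(isOpen_lt continuous_const continuous_re).mem_nhds hs] with z hz using ih hz
    have hd := (((hasDerivAt_id s).mul (hderiv r hs)).sub
      ((hderiv (r - 1) hs).const_mul (r : ℂ))).const_mul ((-1 : ℂ) ^ r)
    rw [iteratedDeriv_succ, hev.deriv_eq]
    refine hd.deriv.trans ?_
    rcases r with _ | r
    · simp; ring
    · simp only [Nat.add_sub_cancel, id]
      push_cast
      ring

lemma hasDerivAt_log_pow_div {r : ℕ} (hr : 1 ≤ r) {t : ℝ} (ht : 0 < t) :
    HasDerivAt (fun t ↦ Real.log t ^ r / t)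
      (Real.log t ^ (r - 1) * (r - Real.log t) / t ^ 2) t := by
  refine (((Real.hasDerivAt_log ht.ne').fun_pow r).div (hasDerivAt_id t) ht.ne').congr_deriv ?_
  obtain ⟨r, rfl⟩ := Nat.exists_eq_add_of_le' hr
  simp only [Nat.add_sub_cancel, id]
  field_simp
  ring

lemma continuousAt_deriv_log_pow_div (r : ℕ) {t : ℝ} (ht : 0 < t) :
    ContinuousAt (fun t ↦ Real.log t ^ (r - 1) * (r - Real.log t) / t ^ 2) t := by
  have := Real.continuousAt_log ht.ne'
  have := ht.ne'
  fun_prop (disch := positivity)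

lemma tendsto_log_pow_div_atTop (r : ℕ) :
    Tendsto (fun t : ℝ ↦ Real.log t ^ r / t) atTop (𝓝 0) := by
  simpa using Real.tendsto_pow_log_div_mul_add_atTop 1 0 r one_ne_zero

lemma integrableOn_deriv_log_pow_div (r : ℕ) {X : ℝ} (hX : 0 < X) :
    IntegrableOn (fun t ↦ Real.log t ^ (r - 1) * (r - Real.log t) / t ^ 2) (Set.Ioi X) := by
  refine IntegrableOn.mono_set ?_ Set.Ioi_subset_Ici_self
  refine LocallyIntegrableOn.integrableOn_of_isBigO_atTop (g := fun t : ℝ ↦ t ^ (-(3 / 2) : ℝ))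
    (ContinuousOn.locallyIntegrableOn (fun t ht ↦
      (continuousAt_deriv_log_pow_div r (hX.trans_le ht)).continuousWithinAt) measurableSet_Ici) ?_
    ⟨Set.Ioi 1, Ioi_mem_atTop 1, integrableOn_Ioi_rpow_of_lt (by norm_num) one_pos⟩
  have h₁ : (fun t : ℝ ↦ Real.log t ^ (r - 1) * (r - Real.log t)) =O[atTop]
      (fun t ↦ t ^ (1 / 2 : ℝ)) := by
    have := ((log_pow_isBigO_rpow (r - 1) (one_half_pos (α := ℝ))).const_mul_left r).sub
      (log_pow_isBigO_rpow (r - 1 + 1) (one_half_pos (α := ℝ)))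
    refine this.congr_left fun t ↦ ?_
    ring
  refine (h₁.mul (isBigO_refl (fun t : ℝ ↦ (t ^ 2)⁻¹) atTop)).congr' (.of_forall fun t ↦ ?_) ?_
  · exact (div_eq_mul_inv _ _).symm
  · filter_upwards [eventually_gt_atTop 0] with t ht
    rw [← Real.rpow_natCast, ← Real.rpow_neg ht.le, ← Real.rpow_add ht]
    norm_num

lemma integral_deriv_log_pow_div_mul_sawSum [NeZero q] (χ : DirichletCharacter ℂ q) (r : ℕ) {X : ℝ}
    (hX : 0 < X) :
    ∫ t in Set.Ioi X, ((Real.log t ^ (r - 1) * (r - Real.log t) / t ^ 2 : ℝ) : ℂ) * χ.sawSum t =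
      ∑ a ∈ Finset.Icc 1 q, χ (a : ZMod q) * (((1 / q) * ∫ u in Set.Ioi (X / q),
        saw (u - a / q) * (Real.log (q * u)) ^ (r - 1) * (r - Real.log (q * u)) / u ^ 2
        : ℝ) : ℂ) := by
  have hq : (0 : ℝ) < q := mod_cast NeZero.pos q
  set g : ℝ → ℝ := fun t ↦ Real.log t ^ (r - 1) * (r - Real.log t) / t ^ 2 with hg
  have hint (a : ℕ) : IntegrableOn (fun t ↦ g t * saw ((t - a) / q)) (Set.Ioi X) := by
    refine (integrableOn_deriv_log_pow_div r hX).mul_bdd (c := 1 / 2) ?_ (.of_forall fun t ↦ ?_)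
    · exact (measurable_saw.comp (by fun_prop)).aestronglyMeasurable
    · exact abs_saw_le _
  have hcoe (a : ℕ) : (fun t ↦ χ (a : ZMod q) * ((g t * saw ((t - a) / q) : ℝ) : ℂ)) =
      fun t ↦ (g t : ℂ) * (χ (a : ZMod q) * (saw ((t - a) / q) : ℂ)) := by
    ext t
    push_cast
    ring
  simp_rw [sawSum, Finset.mul_sum]
  rw [integral_finsetSum _ fun a _ ↦ by
    rw [← hcoe a]; exact ((hint a).ofReal (𝕜 := ℂ)).const_mul _]
  refine Finset.sum_congr rfl fun a _ ↦ ?_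
  rw [← hcoe a, integral_const_mul, integral_complex_ofReal]
  congr 2
  have := integral_comp_mul_left_Ioi (fun t ↦ g t * saw ((t - a) / q)) (X / q) hq
  rw [mul_div_cancel₀ _ hq.ne', smul_eq_mul, eq_comm, inv_mul_eq_iff_eq_mul₀ hq.ne'] at this
  rw [this, ← integral_const_mul, ← integral_const_mul]
  refine setIntegral_congr_fun measurableSet_Ioi fun u hu ↦ ?_
  have hu : 0 < u := (div_pos hX hq).trans hu
  have : ((q * u - a) / q : ℝ) = u - a / q := by field_simp
  simp only [hg, this]
  field_simp

lemma neg_one_pow_mul_iteratedDeriv_LFunction_one [NeZero q] {χ : DirichletCharacter ℂ q}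
    (hχ : χ ≠ 1) {r : ℕ} (hr : 1 ≤ r) :
    IntegrableOn (fun t ↦ ((Real.log t ^ (r - 1) * (r - Real.log t) / t ^ 2 : ℝ) : ℂ) *
      χ.partialSum t) (Set.Ioi 0) ∧
    (-1) ^ r * iteratedDeriv r (LFunction χ) 1 =
      -∫ t in Set.Ioi 0, ((Real.log t ^ (r - 1) * (r - Real.log t) / t ^ 2 : ℝ) : ℂ) *
        χ.partialSum t := by
  have hconv (k : ℕ) := (mellinConvergent_and_hasDerivAt_logMellin hχ k (w := -1) (by simp)).1
  have heq : Set.EqOn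
      (fun t : ℝ ↦
        (r : ℂ) * ((t : ℂ) ^ (-1 - 1 : ℂ) • ((Real.log t : ℂ) ^ (r - 1) * χ.partialSum t)) -
        (t : ℂ) ^ (-1 - 1 : ℂ) • ((Real.log t : ℂ) ^ r * χ.partialSum t))
      (fun t ↦ ((Real.log t ^ (r - 1) * (r - Real.log t) / t ^ 2 : ℝ) : ℂ) * χ.partialSum t)
      (Set.Ioi 0) := by
    intro t ht
    obtain ⟨r, rfl⟩ := Nat.exists_eq_add_of_le' hr
    have : (t : ℂ) ^ (-1 - 1 : ℂ) = ((t : ℂ) ^ 2)⁻¹ := by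
      rw [show (-1 - 1 : ℂ) = -((2 : ℕ) : ℂ) by norm_num, cpow_neg, cpow_natCast]
    simp only [smul_eq_mul, this]
    push_cast [Nat.add_sub_cancel]
    ring
  have hint := ((hconv (r - 1)).const_mul (r : ℂ)).sub (hconv r)
  refine ⟨IntegrableOn.congr_fun hint heq measurableSet_Ioi, ?_⟩
  rw [← setIntegral_congr_fun measurableSet_Ioi heq,
    integral_sub ((hconv (r - 1)).const_mul (r : ℂ)) (hconv r), integral_const_mul,
    iteratedDeriv_LFunction_eq hχ r (by simp), ← mul_assoc, ← mul_pow]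
  simp [logMellin, mellin]

lemma sum_mul_log_pow_div_eq [NeZero q] {χ : DirichletCharacter ℂ q} (hχ : χ ≠ 1)
    {r : ℕ} (hr : 1 ≤ r) (X : ℝ) :
    ∑ n ∈ Finset.Icc 1 ⌊X⌋₊, χ (n : ZMod q) * (Real.log n : ℂ) ^ r / (n : ℂ) =
      ((Real.log X ^ r / X : ℝ) : ℂ) * χ.partialSum X -
      ∫ t in Set.Ioc 0 X, ((Real.log t ^ (r - 1) * (r - Real.log t) / t ^ 2 : ℝ) : ℂ) *
        χ.partialSum t := by
  have hd {t : ℝ} (ht : t ∈ Set.Icc 1 X) := (hasDerivAt_log_pow_div hr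
    (zero_lt_one.trans_le ht.1)).ofReal_comp
  have hcont : ContinuousOn
      (fun t ↦ ((Real.log t ^ (r - 1) * (r - Real.log t) / t ^ 2 : ℝ) : ℂ)) (Set.Icc 1 X) :=
    fun t ht ↦ (continuous_ofReal.continuousAt.comp
      (continuousAt_deriv_log_pow_div r (zero_lt_one.trans_le ht.1))).continuousWithinAt
  have key := sum_mul_eq_sub_integral_mul₀ (f := fun t ↦ ((Real.log t ^ r / t : ℝ) : ℂ))
    (fun n ↦ χ (n : ZMod q)) (by simp [apply_zero_of_ne_one hχ]) X
    (fun t ht ↦ (hd ht).differentiableAt)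
    (hcont.integrableOn_Icc.congr_fun (fun t ht ↦ (hd ht).deriv.symm) measurableSet_Icc)
  rw [← Finset.add_sum_Ioc_eq_sum_Icc (Nat.zero_le _), Nat.cast_zero, Nat.cast_zero,
    apply_zero_of_ne_one hχ, mul_zero, zero_add] at key
  convert! key using 1
  · refine Finset.sum_congr rfl fun n _ ↦ ?_
    push_cast
    ring
  · congr 1
    symm
    rw [← integral_Icc_eq_integral_Ioc]
    refine Eq.trans (setIntegral_congr_fun measurableSet_Icc fun t ht ↦ ?_)
      (setIntegral_eq_of_subset_of_forall_sdiff_eq_zero measurableSet_Ioc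
        (fun t ht ↦ ⟨zero_lt_one.trans_le ht.1, ht.2⟩) fun t ht ↦ ?_).symm
    · simp only [(hd ht).deriv, partialSum]
    · have : t < 1 := not_le.mp fun h ↦ ht.2 ⟨h, ht.1.2⟩
      simp [partialSum_of_lt_one hχ this]

end DirichletCharacter

/-- for a primitive Dirichlet character `χ` mod `q ≥ 3`, `r ≥ 1`, `X > 0`,
`(-1)^r L^{(r)}(1,χ) = ∑_{n ≤ X} χ(n)(log n)^r/n + ∑_{a=1}^q χ(a)·[ψ((X-a)/q)(log X)^r/X
  + (1/q)∫_{X/q}^∞ ψ(u-a/q)(log qu)^{r-1}(r - log qu)/u² du]`. -/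
theorem stmt12 (q : ℕ) [NeZero q] (hq : 3 ≤ q) (χ : DirichletCharacter ℂ q)
    (hχ : χ.IsPrimitive) (r : ℕ) (hr : 1 ≤ r) (X : ℝ) (hX : 0 < X) :
    (-1) ^ r * iteratedDeriv r (DirichletCharacter.LFunction χ) 1 =
      (∑ n ∈ Finset.Icc 1 ⌊X⌋₊, χ (n : ZMod q) * (Real.log n : ℂ) ^ r / (n : ℂ))
      + ∑ a ∈ Finset.Icc 1 q, χ (a : ZMod q) *
          ((saw ((X - a) / q) * (Real.log X) ^ r / X
            + (1 / q) * ∫ u in Set.Ioi (X / q),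
                saw (u - a / q) * (Real.log (q * u)) ^ (r - 1) * (r - Real.log (q * u)) / u ^ 2
            : ℝ) : ℂ) := by
  have hχ₁ := DirichletCharacter.ne_one_of_isPrimitive hq hχ
  obtain ⟨hint, hL⟩ := DirichletCharacter.neg_one_pow_mul_iteratedDeriv_LFunction_one hχ₁ hr
  have hg : IntegrableOn
      (fun t ↦ ((Real.log t ^ (r - 1) * (r - Real.log t) / t ^ 2 : ℝ) : ℂ)) (Set.Ioi X) :=
    (DirichletCharacter.integrableOn_deriv_log_pow_div r hX).ofReal
  have hgS := hg.mul_bdd (c := q) χ.measurable_sawSum.aestronglyMeasurable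
    (.of_forall χ.norm_sawSum_le)
  have htail : ∫ t in Set.Ioi X, ((Real.log t ^ (r - 1) * (r - Real.log t) / t ^ 2 : ℝ) : ℂ) *
      χ.partialSum t = -((Real.log X ^ r / X : ℝ) : ℂ) * χ.sawSum 0 -
      ∫ t in Set.Ioi X, ((Real.log t ^ (r - 1) * (r - Real.log t) / t ^ 2 : ℝ) : ℂ) *
        χ.sawSum t := by
    have hf := integral_Ioi_of_hasDerivAt_of_tendsto'
      (fun t ht ↦ DirichletCharacter.hasDerivAt_log_pow_div hr (hX.trans_le ht))
      (DirichletCharacter.integrableOn_deriv_log_pow_div r hX)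
      (DirichletCharacter.tendsto_log_pow_div_atTop r)
    rw [zero_sub] at hf
    rw [← ofReal_neg, ← hf, ← integral_complex_ofReal, ← integral_mul_const,
      ← integral_sub (hg.mul_const _) hgS]
    refine setIntegral_congr_fun measurableSet_Ioi fun t ht ↦ ?_
    simp only [← DirichletCharacter.partialSum_add_sawSum hχ₁ (hX.trans ht).le]
    ring
  have hS : ∑ a ∈ Finset.Icc 1 q, χ (a : ZMod q) *
      ((saw ((X - a) / q) * (Real.log X) ^ r / X : ℝ) : ℂ) =
      ((Real.log X ^ r / X : ℝ) : ℂ) * χ.sawSum X := by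
    rw [DirichletCharacter.sawSum, Finset.mul_sum]
    refine Finset.sum_congr rfl fun a _ ↦ ?_
    push_cast
    ring
  simp_rw [ofReal_add, mul_add, Finset.sum_add_distrib]
  rw [hS, ← χ.integral_deriv_log_pow_div_mul_sawSum r hX,
    DirichletCharacter.sum_mul_log_pow_div_eq hχ₁ hr X, hL, ← Set.Ioc_union_Ioi_eq_Ioi hX.le,
    setIntegral_union Set.Ioc_disjoint_Ioi_same measurableSet_Ioi
      (hint.mono_set Set.Ioc_subset_Ioi_self) (hint.mono_set (Set.Ioi_subset_Ioi hX.le)), htail,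
    ← DirichletCharacter.partialSum_add_sawSum hχ₁ hX.le]
  ring
end

section
/- For a primitive Dirichlet character χ modulo q ≥ 3 and every integer r ≥ 1, L^{(r)}(0,χ) = (-1)^r ∑_{n ≤ q·e^{r-1}} χ(n)(log n)^r + O( q^{1/2} log q · (log q + r)^r ), with an absolute implied constant. -/
open Complex Filter Topology

lemma norm_geom_sum_le_inv_sin (x : ℝ) (hx : Real.sin x ≠ 0) (N : ℕ) :
    ‖∑ j ∈ Finset.range N, (cexp (2 * x * I)) ^ j‖ ≤ 1 / |Real.sin x| := by
  have h1 : ‖cexp (2 * x * I) - 1‖ = 2 * |Real.sin x| := by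
    have := Complex.norm_exp_I_mul_ofReal_sub_one (2 * x)
    rw [show (2 * x / 2) = x by ring, norm_mul, Real.norm_eq_abs, Real.norm_eq_abs, abs_two] at this
    rw [← this]; push_cast; ring_nf
  have h0 : cexp (2 * x * I) ≠ 1 := by
    intro h; rw [h] at h1; simp at h1; exact hx h1
  have h2 : 0 < |Real.sin x| := abs_pos.2 hx
  rw [geom_sum_eq h0, norm_div, h1, div_le_div_iff₀ (by positivity) h2]
  have h3 : ‖cexp (2 * x * I) ^ N - 1‖ ≤ 2 := by
    refine (norm_sub_le _ _).trans ?_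
    have : ‖cexp (2 * x * I)‖ = 1 := by
      simpa using Complex.norm_exp_ofReal_mul_I (2 * x)
    rw [norm_pow, this]; norm_num
  nlinarith

lemma inv_sin_pi_mul_div_le {k q : ℕ} (hk : 0 < k) (hkq : k < q) :
    1 / |Real.sin (Real.pi * k / q)| ≤ (q : ℝ) / 2 * (1 / k + 1 / (q - k)) ∧
      Real.sin (Real.pi * k / q) ≠ 0 := by
  have hk' : (0 : ℝ) < k := by exact_mod_cast hk
  have hkq' : (k : ℝ) < q := by exact_mod_cast hkq
  have hq : (0 : ℝ) < q := hk'.trans hkq'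
  have hqk : (0 : ℝ) < q - k := by linarith
  have key : min (2 * (k : ℝ) / q) (2 * ((q : ℝ) - k) / q) ≤ Real.sin (Real.pi * k / q) := by
    rcases le_total (2 * (k : ℝ)) q with h | h
    · refine (min_le_left _ _).trans ?_
      have := Real.mul_le_sin (x := Real.pi * k / q) (by positivity) (by
        rw [div_le_div_iff₀ hq two_pos]; nlinarith [Real.pi_pos])
      refine le_trans (le_of_eq ?_) this
      field_simp [Real.pi_pos.ne']
    · refine (min_le_right _ _).trans ?_
      have := Real.mul_le_sin (x := Real.pi - Real.pi * k / q) (by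
        rw [sub_nonneg, div_le_iff₀ hq]; nlinarith [Real.pi_pos]) (by
        have : Real.pi / 2 ≤ Real.pi * k / q := by
          rw [div_le_div_iff₀ two_pos hq]; nlinarith [Real.pi_pos]
        linarith)
      rw [Real.sin_pi_sub] at this
      refine le_trans (le_of_eq ?_) this
      field_simp [Real.pi_pos.ne']
  have hpos : 0 < Real.sin (Real.pi * k / q) := lt_of_lt_of_le (by positivity) key
  refine ⟨?_, hpos.ne'⟩
  rw [abs_of_pos hpos]
  rcases min_le_iff.1 key with h | h
  · refine (one_div_le_one_div_of_le (by positivity) h).trans ?_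
    have : (q : ℝ) / 2 * (1 / k + 1 / (q - k)) = 1 / (2 * k / q) + q / 2 * (1 / (q - k)) := by
      field_simp
    rw [this]
    have : 0 ≤ (q : ℝ) / 2 * (1 / (q - k)) := by positivity
    linarith
  · refine (one_div_le_one_div_of_le (by positivity) h).trans ?_
    have : (q : ℝ) / 2 * (1 / k + 1 / (q - k)) = 1 / (2 * (q - k) / q) + q / 2 * (1 / k) := by
      field_simp; ring
    rw [this]
    have : 0 ≤ (q : ℝ) / 2 * (1 / k) := by positivity
    linarith

lemma sum_inv_add_inv_le (q : ℕ) (hq : 2 ≤ q) :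
    ∑ k ∈ Finset.Ico 1 q, (q : ℝ) / 2 * (1 / k + 1 / (q - k)) ≤ q * (1 + Real.log q) := by
  have hH : ∑ k ∈ Finset.Ico 1 q, (1 : ℝ) / k ≤ 1 + Real.log q := by
    have h := harmonic_le_one_add_log (q - 1)
    have h2 : ((harmonic (q - 1) : ℚ) : ℝ) = ∑ k ∈ Finset.Ico 1 q, (1 : ℝ) / k := by
      rw [Finset.sum_Ico_eq_sum_range, harmonic]
      push_cast
      refine Finset.sum_congr rfl fun i _ => ?_
      rw [one_div, add_comm]
    rw [← h2]
    refine h.trans ?_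
    gcongr
    · exact_mod_cast (by omega : 0 < q - 1)
    · omega
  have hR : ∑ k ∈ Finset.Ico 1 q, (1 : ℝ) / (q - k) = ∑ k ∈ Finset.Ico 1 q, (1 : ℝ) / k := by
    have h := Finset.sum_Ico_reflect (fun k : ℕ => (1 : ℝ) / k) 1 (Nat.le_succ q)
    rw [Nat.add_sub_cancel_left, Nat.add_sub_cancel] at h
    rw [← h]
    refine Finset.sum_congr rfl fun k hk => ?_
    rw [Nat.cast_sub (Finset.mem_Ico.1 hk).2.le]
  rw [← Finset.mul_sum, Finset.sum_add_distrib, hR]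
  have : (0 : ℝ) ≤ q := by positivity
  nlinarith

open ZMod in
lemma norm_sq_gaussSum_of_isPrimitive {q : ℕ} [NeZero q] {χ : DirichletCharacter ℂ q}
    (hχ : χ.IsPrimitive) : ‖gaussSum χ (stdAddChar (N := q))‖ ^ 2 = q := by
  have h := congrFun (ZMod.dft_dft (N := q) (fun j => χ j)) (-1)
  simp only [neg_neg, map_one, smul_eq_mul, mul_one] at h
  rw [dft_apply] at h
  have hd (k : ZMod q) := hχ.fourierTransform_eq_inv_mul_gaussSum k
  simp only [smul_eq_mul] at h
  have h3 : ∑ j : ZMod q, stdAddChar (-(j * -1)) * dft (fun j => χ j) j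
      = gaussSum χ (stdAddChar (N := q)) * star (gaussSum χ (stdAddChar (N := q))) := by
    rw [gaussSum, star_sum, ← gaussSum, Finset.mul_sum]
    refine Fintype.sum_equiv (Equiv.neg _) _ _ fun j => ?_
    have := hd j
    rw [show (fun j => χ j) = (χ : ZMod q → ℂ) from rfl, this]
    simp only [Equiv.neg_apply, star_mul', MulChar.star_apply', mul_neg, mul_one, neg_neg]
    rw [AddChar.map_neg_eq_conj, starRingEnd_apply, star_star]
    ring
  rw [h3, Complex.star_def, Complex.mul_conj, Complex.normSq_eq_norm_sq] at h
  exact_mod_cast h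

open ZMod in
/-- The Pólya–Vinogradov inequality. -/
lemma norm_sum_range_le_of_isPrimitive {q : ℕ} [NeZero q] (hq : 2 ≤ q) {χ : DirichletCharacter ℂ q}
    (hχ : χ.IsPrimitive) (N : ℕ) :
    ‖∑ j ∈ Finset.range N, χ (j : ZMod q)‖ ≤ √q * (1 + Real.log q) := by
  have : Fact (1 < q) := ⟨hq⟩
  have hq0 : (0 : ℝ) < q := by positivity
  have hτ : ‖gaussSum χ (stdAddChar (N := q))‖ = √q := by
    rw [← norm_sq_gaussSum_of_isPrimitive hχ, Real.sqrt_sq (norm_nonneg _)]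
  have hinv (j : ZMod q) : (q : ℂ) * χ j = ∑ k : ZMod q, stdAddChar (k * j) *
      (χ⁻¹ (-k) * gaussSum χ stdAddChar) := by
    have h := congrFun (ZMod.dft_dft (N := q) (χ : ZMod q → ℂ)) (-j)
    simp only [neg_neg, smul_eq_mul] at h
    rw [← h, dft_apply]
    refine Finset.sum_congr rfl fun k _ => ?_
    rw [hχ.fourierTransform_eq_inv_mul_gaussSum, smul_eq_mul, mul_neg, neg_neg]
  have hsum : (q : ℂ) * ∑ j ∈ Finset.range N, χ (j : ZMod q) = ∑ k : ZMod q,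
      (χ⁻¹ (-k) * gaussSum χ stdAddChar) * ∑ j ∈ Finset.range N, stdAddChar (k * (j : ZMod q)) := by
    simp_rw [Finset.mul_sum, hinv]
    rw [Finset.sum_comm]
    refine Finset.sum_congr rfl fun k _ => Finset.sum_congr rfl fun j _ => ?_
    ring
  have hterm (m : ℕ) (hm : m ∈ Finset.Ico 1 q) :
      ‖∑ j ∈ Finset.range N, stdAddChar ((m : ZMod q) * (j : ZMod q))‖
        ≤ (q : ℝ) / 2 * (1 / m + 1 / (q - m)) := by
    obtain ⟨h1, h2⟩ := Finset.mem_Ico.1 hm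
    obtain ⟨hb, hs⟩ := inv_sin_pi_mul_div_le h1 h2
    refine le_trans ?_ ((norm_geom_sum_le_inv_sin _ hs N).trans hb)
    refine le_of_eq (congrArg _ (Finset.sum_congr rfl fun j _ => ?_))
    have := ZMod.stdAddChar_coe (N := q) ((m : ℤ) * j)
    push_cast at this
    rw [this, ← Complex.exp_nat_mul]
    congr 1
    push_cast
    ring
  have hsplit : ∑ k : ZMod q, ‖χ⁻¹ (-k) * gaussSum χ stdAddChar‖ *
      ‖∑ j ∈ Finset.range N, stdAddChar (k * (j : ZMod q))‖ ≤ √q * (q * (1 + Real.log q)) := by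
    have e : ∑ k : ZMod q, ‖χ⁻¹ (-k) * gaussSum χ stdAddChar‖ *
      ‖∑ j ∈ Finset.range N, stdAddChar (k * (j : ZMod q))‖ = ∑ m ∈ Finset.range q,
      ‖χ⁻¹ (-(m : ZMod q)) * gaussSum χ stdAddChar‖ *
      ‖∑ j ∈ Finset.range N, stdAddChar ((m : ZMod q) * (j : ZMod q))‖ := by
      refine Finset.sum_bij' (fun k _ => k.val) (fun m _ => (m : ZMod q)) ?_ ?_ ?_ ?_ ?_
      · intro k _; exact Finset.mem_range.2 k.val_lt
      · simp
      · intro k _; simp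
      · intro m hm; exact ZMod.val_cast_of_lt (Finset.mem_range.1 hm)
      · intro k _; simp
    rw [e, Finset.range_eq_Ico, Finset.sum_eq_sum_Ico_succ_bot (by omega)]
    have hz : χ⁻¹ (-((0 : ℕ) : ZMod q)) = 0 := by
      rw [Nat.cast_zero, neg_zero]
      exact MulChar.map_nonunit _ not_isUnit_zero
    rw [hz, zero_mul, norm_zero, zero_mul, zero_add, zero_add]
    refine le_trans ?_ (mul_le_mul_of_nonneg_left (sum_inv_add_inv_le q hq) (Real.sqrt_nonneg _))
    rw [Finset.mul_sum]
    refine Finset.sum_le_sum fun m hm => ?_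
    rw [norm_mul, hτ]
    refine mul_le_mul ?_ (hterm m hm) (norm_nonneg _) (Real.sqrt_nonneg _)
    exact mul_le_of_le_one_left (Real.sqrt_nonneg _) (DirichletCharacter.norm_le_one _ _)
  have hfin : (q : ℝ) * ‖∑ j ∈ Finset.range N, χ (j : ZMod q)‖ ≤ √q * (q * (1 + Real.log q)) := by
    have : (q : ℝ) * ‖∑ j ∈ Finset.range N, χ (j : ZMod q)‖
        = ‖(q : ℂ) * ∑ j ∈ Finset.range N, χ (j : ZMod q)‖ := by
      rw [norm_mul, Complex.norm_natCast]
    rw [this, hsum]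
    refine (norm_sum_le _ _).trans (le_trans (le_of_eq ?_) hsplit)
    simp_rw [norm_mul]
  rw [← mul_le_mul_iff_right₀ hq0]
  linarith

section
open MeasureTheory Set

variable {a : ℝ → ℂ} {T M X : ℝ}

lemma intervalIntegrable_of_measurable_of_norm_le (ha : Measurable a) (hM : ∀ x, ‖a x‖ ≤ M)
    (u v : ℝ) : IntervalIntegrable a volume u v :=
  (intervalIntegrable_const (c := M)).mono_fun ha.aestronglyMeasurable
    (.of_forall fun x => (hM x).trans (le_abs_self M))

lemma norm_integral_le_of_periodic (ha : Measurable a) (hM : ∀ x, ‖a x‖ ≤ M) (hT : 0 < T)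
    (hp : Function.Periodic a T) (h0 : ∫ x in (0 : ℝ)..T, a x = 0) (u : ℝ) :
    ‖∫ x in X..u, a x‖ ≤ M * T := by
  have hint := intervalIntegrable_of_measurable_of_norm_le ha hM
  have hper : Function.Periodic (fun u => ∫ x in X..u, a x) T := fun u => by
    have h1 := hp.intervalIntegral_add_eq u 0
    rw [zero_add, h0] at h1
    change ∫ x in X..(u + T), a x = ∫ x in X..u, a x
    rw [← intervalIntegral.integral_add_adjacent_intervals (hint X u) (hint u (u + T)), h1,
      add_zero]
  obtain ⟨y, hy, hyu⟩ := hper.exists_mem_Ico hT u X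
  change ∫ x in X..u, a x = ∫ x in X..y, a x at hyu
  rw [hyu]
  have hM0 : 0 ≤ M := (norm_nonneg _).trans (hM 0)
  refine (intervalIntegral.norm_integral_le_of_norm_le_const fun x _ => hM x).trans ?_
  rw [abs_of_nonneg (by linarith [hy.1])]
  exact mul_le_mul_of_nonneg_left (by linarith [hy.2]) hM0

lemma continuous_integral_of_norm_le (ha : Measurable a) (hM : ∀ x, ‖a x‖ ≤ M) :
    Continuous fun u => ∫ x in X..u, a x :=
  intervalIntegral.continuous_primitive (intervalIntegrable_of_measurable_of_norm_le ha hM) X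

lemma norm_ofReal_cpow_neg_add_two {t : ℝ} (ht : 0 < t) (s : ℂ) :
    ‖(t : ℂ) ^ (-(s + 2))‖ = t ^ (-s.re - 2) := by
  rw [Complex.norm_cpow_eq_rpow_re_of_pos ht]
  congr 1
  simp
  ring

lemma integrableOn_mul_cpow {B : ℝ → ℂ} {K : ℝ} (hB : Measurable B) (hK : ∀ x, ‖B x‖ ≤ K)
    (hX : 0 < X) {w : ℂ} (hw : w.re < -1) :
    IntegrableOn (fun t : ℝ => B t * (t : ℂ) ^ w) (Ioi X) :=
  (integrableOn_Ioi_cpow_of_lt hw hX).bdd_mul hB.aestronglyMeasurable (.of_forall hK)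

lemma integral_mul_cpow_by_parts (ha : Measurable a) (hM : ∀ x, ‖a x‖ ≤ M) (hT : 0 < T)
    (hp : Function.Periodic a T) (h0 : ∫ x in (0 : ℝ)..T, a x = 0)
    (hr : ∀ x, ContinuousWithinAt a (Ioi x) x) (hX : 0 < X) {s : ℂ} (hs : 0 < s.re) :
    ∫ t in Ioi X, a t * (t : ℂ) ^ (-(s + 1)) =
      (s + 1) * ∫ t in Ioi X, (∫ x in X..t, a x) * (t : ℂ) ^ (-(s + 2)) := by
  set B : ℝ → ℂ := fun t => ∫ x in X..t, a x with hBdef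
  have hBc : Continuous B := continuous_integral_of_norm_le ha hM
  have hBb : ∀ t, ‖B t‖ ≤ M * T := norm_integral_le_of_periodic ha hM hT hp h0
  have hint := intervalIntegrable_of_measurable_of_norm_le ha hM
  have hBd (x : ℝ) : HasDerivWithinAt B (a x) (Ioi x) x :=
    (intervalIntegral.integral_hasDerivWithinAt_right (hint X x) (s := Ici x) (t := Ioi x)
      ha.stronglyMeasurable.stronglyMeasurableAtFilter (hr x)).mono Ioi_subset_Ici_self
  have hI1 : IntegrableOn (fun t : ℝ => a t * (t : ℂ) ^ (-(s + 1))) (Ioi X) :=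
    integrableOn_mul_cpow ha hM hX (by simp; linarith)
  have hI2 : IntegrableOn (fun t : ℝ => B t * (t : ℂ) ^ (-(s + 2))) (Ioi X) :=
    integrableOn_mul_cpow hBc.measurable hBb hX (by simp; linarith)
  have hparts (Y : ℝ) (hY : X ≤ Y) : ∫ t in X..Y, a t * (t : ℂ) ^ (-(s + 1)) =
      (Y : ℂ) ^ (-(s + 1)) * B Y + (s + 1) * ∫ t in X..Y, B t * (t : ℂ) ^ (-(s + 2)) := by
    have hne (t : ℝ) (ht : t ∈ uIcc X Y) : t ≠ 0 := by
      rw [uIcc_of_le hY] at ht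
      exact (hX.trans_le ht.1).ne'
    have hd (t : ℝ) (ht : t ≠ 0) : HasDerivAt (fun t : ℝ => (t : ℂ) ^ (-(s + 1)))
        (-(s + 1) * (t : ℂ) ^ (-(s + 2))) t := by
      have h := hasDerivAt_ofReal_cpow_const' (r := -(s + 2)) ht (by
        intro h; have := congrArg Complex.re h; simp at this; linarith)
      have h2 := h.const_mul (-(s + 1))
      have hs1 : s + 1 ≠ 0 := by
        intro h; have := congrArg Complex.re h; simp at this; linarith
      have e : -(s + 2) + 1 = -(s + 1) := by ring
      simp only [e] at h2
      refine h2.congr_of_eventuallyEq (.of_forall fun t => ?_)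
      field_simp
    have hc (w : ℂ) : ContinuousOn (fun t : ℝ => (t : ℂ) ^ w) (uIcc X Y) := fun t ht =>
      (Complex.continuousAt_ofReal_cpow_const _ _ (Or.inr (hne t ht))).continuousWithinAt
    have h := intervalIntegral.integral_mul_deriv_eq_deriv_mul_of_hasDeriv_right
      (u := fun t : ℝ => (t : ℂ) ^ (-(s + 1))) (u' := fun t : ℝ => -(s + 1) * (t : ℂ) ^ (-(s + 2)))
      (v := B) (v' := a) (a := X) (b := Y) (hc _) hBc.continuousOn
      (fun x hx => (hd x (hne x (Ioo_subset_Icc_self hx))).hasDerivWithinAt)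
      (fun x _ => hBd x) ((hc _).const_smul (-(s + 1))).intervalIntegrable (hint X Y)
    have hBX : B X = 0 := intervalIntegral.integral_same
    rw [hBX, mul_zero, sub_zero] at h
    have h2 : ∫ t in X..Y, -(s + 1) * (t : ℂ) ^ (-(s + 2)) * B t =
        -(s + 1) * ∫ t in X..Y, B t * (t : ℂ) ^ (-(s + 2)) := by
      rw [← intervalIntegral.integral_const_mul]
      refine intervalIntegral.integral_congr fun t _ => ?_
      ring
    rw [h2] at h
    have h3 : ∫ t in X..Y, a t * (t : ℂ) ^ (-(s + 1)) = ∫ t in X..Y, (t : ℂ) ^ (-(s + 1)) * a t :=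
      intervalIntegral.integral_congr fun t _ => mul_comm _ _
    rw [h3, h]
    ring
  have l1 := intervalIntegral_tendsto_integral_Ioi X hI1 tendsto_id
  have l2 := intervalIntegral_tendsto_integral_Ioi X hI2 tendsto_id
  have l3 : Tendsto (fun Y : ℝ => (Y : ℂ) ^ (-(s + 1)) * B Y) atTop (𝓝 0) := by
    rw [tendsto_zero_iff_norm_tendsto_zero]
    have hz := (tendsto_rpow_neg_atTop (y := s.re + 1) (by linarith)).mul_const (M * T)
    rw [zero_mul] at hz
    refine squeeze_zero' (.of_forall fun _ => norm_nonneg _) ?_ hz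
    filter_upwards [eventually_gt_atTop 0] with Y hY
    rw [norm_mul, Complex.norm_cpow_eq_rpow_re_of_pos hY]
    have e : (-(s + 1)).re = -(s.re + 1) := by simp
    rw [e]
    exact mul_le_mul_of_nonneg_left (hBb Y) (Real.rpow_nonneg hY.le _)
  have l4 := l3.add (l2.const_mul (s + 1))
  rw [zero_add] at l4
  refine tendsto_nhds_unique l1 (l4.congr' ?_)
  filter_upwards [eventually_ge_atTop X] with Y hY
  exact (hparts Y hY).symm

lemma norm_integral_mul_cpow_le {B : ℝ → ℂ} {K : ℝ} (hK : ∀ x, ‖B x‖ ≤ K) (hX : 0 < X) {s : ℂ}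
    (hs : -1 < s.re) :
    ‖∫ t in Ioi X, B t * (t : ℂ) ^ (-(s + 2))‖ ≤ K * (X ^ (-s.re - 1) / (s.re + 1)) := by
  have hi := integrableOn_Ioi_rpow_of_lt (a := -s.re - 2) (by linarith) hX
  have h := norm_integral_le_of_norm_le (f := fun t : ℝ => B t * (t : ℂ) ^ (-(s + 2)))
    (hi.const_mul K) (by
      filter_upwards [self_mem_ae_restrict measurableSet_Ioi] with t ht
      rw [norm_mul, norm_ofReal_cpow_neg_add_two (hX.trans ht)]
      exact mul_le_mul_of_nonneg_right (hK t) (Real.rpow_nonneg (hX.trans ht).le _))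
  refine h.trans (le_of_eq ?_)
  rw [integral_const_mul, integral_Ioi_rpow_of_lt (by linarith) hX]
  rw [show -s.re - 2 + 1 = -s.re - 1 by ring, show -s.re - 1 = -(s.re + 1) by ring,
    neg_div_neg_eq]

lemma differentiableAt_integral_mul_cpow {B : ℝ → ℂ} {K : ℝ} (hB : Continuous B)
    (hK : ∀ x, ‖B x‖ ≤ K) (hX : 0 < X) {s : ℂ} (hs : -1 < s.re) :
    DifferentiableAt ℂ (fun s : ℂ => ∫ t in Ioi X, B t * (t : ℂ) ^ (-(s + 2))) s := by
  have e : (fun s : ℂ => ∫ t in Ioi X, B t * (t : ℂ) ^ (-(s + 2))) =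
      fun s => mellin ((Ioi X).indicator B) (-(s + 1)) := by
    funext s
    rw [mellin]
    have : ∀ t : ℝ, (t : ℂ) ^ (-(s + 1) - 1) • (Ioi X).indicator B t =
        (Ioi X).indicator (fun t : ℝ => B t * (t : ℂ) ^ (-(s + 2))) t := by
      intro t
      by_cases ht : t ∈ Ioi X
      · rw [indicator_of_mem ht, indicator_of_mem ht, smul_eq_mul, mul_comm]
        congr 2
        ring
      · rw [indicator_of_notMem ht, indicator_of_notMem ht, smul_zero]
    simp_rw [this]
    rw [setIntegral_indicator measurableSet_Ioi, inter_eq_right.2 (Ioi_subset_Ioi hX.le)]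
  rw [e]
  refine DifferentiableAt.comp s (g := mellin ((Ioi X).indicator B)) (f := fun s => -(s + 1)) ?_
    (by fun_prop)
  refine mellin_differentiableAt_of_isBigO_rpow (a := 0) (b := -(s.re + 2)) ?_ ?_ (by simp; linarith)
    ?_ (by simp)
  · exact (hB.locallyIntegrable.indicator measurableSet_Ioi).locallyIntegrableOn _
  · refine Asymptotics.IsBigO.of_bound K (.of_forall fun t => ?_)
    simp only [neg_zero, Real.rpow_zero, norm_one, mul_one]
    exact (norm_indicator_le_norm_self _ _).trans (hK t)
  · refine (Asymptotics.isBigO_zero _ _).congr' ?_ .rfl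
    filter_upwards [nhdsWithin_le_nhds (Iio_mem_nhds hX)] with t ht
    rw [indicator_of_notMem (by simpa using (mem_Iio.1 ht).le)]
end

section
open MeasureTheory Set

lemma ne_one_of_isPrimitive {q : ℕ} [NeZero q] (hq : 2 ≤ q) {χ : DirichletCharacter ℂ q}
    (hχ : χ.IsPrimitive) : χ ≠ 1 := by
  rintro rfl
  rw [DirichletCharacter.isPrimitive_def, DirichletCharacter.conductor_one] at hχ
  omega

lemma periodic_sum_range {q : ℕ} [NeZero q] {χ : DirichletCharacter ℂ q} (hχ : χ ≠ 1) :
    Function.Periodic (fun n : ℕ => ∑ k ∈ Finset.range n, χ (k : ZMod q)) q := by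
  intro n
  induction n with
  | zero =>
    simp only [zero_add, Finset.range_zero, Finset.sum_empty]
    rw [← MulChar.sum_eq_zero_of_ne_one hχ]
    refine Finset.sum_bij' (fun m _ => (m : ZMod q)) (fun k _ => k.val) ?_ ?_ ?_ ?_ ?_
    · simp
    · intro k _; exact Finset.mem_range.2 k.val_lt
    · intro m hm; exact ZMod.val_cast_of_lt (Finset.mem_range.1 hm)
    · intro k _; simp
    · simp
  | succ n ih =>
    simp only at ih ⊢
    rw [show n + 1 + q = n + q + 1 by ring, Finset.sum_range_succ, ih, Finset.sum_range_succ]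
    simp

/-- The summatory function of a Dirichlet character as a `q`-periodic function on `ℝ`. -/
noncomputable def charSum {q : ℕ} (χ : DirichletCharacter ℂ q) (u : ℝ) : ℂ :=
  ∑ k ∈ Finset.range ((⌊u⌋ : ZMod q).val + 1), χ (k : ZMod q)

variable {q : ℕ} {χ : DirichletCharacter ℂ q}

lemma charSum_periodic : Function.Periodic (charSum χ) q := by
  intro u
  simp [charSum]

lemma measurable_charSum : Measurable (charSum χ) :=
  (measurable_from_top (f := fun n : ℤ =>
    ∑ k ∈ Finset.range ((n : ZMod q).val + 1), χ (k : ZMod q))).comp Int.measurable_floor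

lemma continuousWithinAt_charSum (x : ℝ) : ContinuousWithinAt (charSum χ) (Ioi x) x := by
  refine tendsto_const_nhds.congr' ?_
  filter_upwards [Ioo_mem_nhdsGT (Int.lt_floor_add_one x)] with y hy
  have : ⌊y⌋ = ⌊x⌋ := Int.floor_eq_iff.2 ⟨(Int.floor_le x).trans hy.1.le, hy.2⟩
  rw [charSum, charSum, this]

lemma charSum_eq_sum_Icc_zero [NeZero q] (hχ : χ ≠ 1) {u : ℝ} (hu : 0 ≤ u) :
    charSum χ u = ∑ k ∈ Finset.Icc 0 ⌊u⌋₊, χ (k : ZMod q) := by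
  have hp : Function.Periodic (fun n : ℕ => ∑ k ∈ Finset.range (n + 1), χ (k : ZMod q)) q := by
    intro n
    have := periodic_sum_range hχ (n + 1)
    simp only at this ⊢
    rw [show n + q + 1 = n + 1 + q by ring, this]
  have h := hp.map_mod_nat ⌊u⌋₊
  rw [charSum, ← Int.natCast_floor_eq_floor hu, Int.cast_natCast, ZMod.val_natCast, h]
  rw [← Nat.range_succ_eq_Icc_zero]

lemma charSum_eq_sum_Icc_one [NeZero q] (hq : 2 ≤ q) (hχ : χ ≠ 1) {u : ℝ} (hu : 0 ≤ u) :
    charSum χ u = ∑ k ∈ Finset.Icc 1 ⌊u⌋₊, χ (k : ZMod q) := by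
  have : Fact (1 < q) := ⟨hq⟩
  rw [charSum_eq_sum_Icc_zero hχ hu, ← Finset.Ioc_insert_left (Nat.zero_le _), Finset.sum_insert
    (by simp), Nat.cast_zero, MulChar.map_nonunit _ not_isUnit_zero, zero_add]
  rfl

lemma LFunction_sub_sum_eq [NeZero q] (hq : 2 ≤ q) (hχ : χ ≠ 1) {M : ℝ}
    (hM : ∀ u, ‖charSum χ u‖ ≤ M) {X : ℝ} (hX : 1 ≤ X) {s : ℂ} (hs : 1 < s.re) :
    χ.LFunction s - ∑ n ∈ Finset.Icc 1 ⌊X⌋₊, χ (n : ZMod q) * (n : ℂ) ^ (-s) =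
      s * (∫ t in Ioi X, charSum χ t * (t : ℂ) ^ (-(s + 1))) - charSum χ X * (X : ℂ) ^ (-s) := by
  have : Fact (1 < q) := ⟨hq⟩
  have hχ0 : χ ((0 : ℕ) : ZMod q) = 0 := by
    rw [Nat.cast_zero]; exact MulChar.map_nonunit _ not_isUnit_zero
  have hs0 : s ≠ 0 := by rintro rfl; simp at hs; linarith
  have hX0 : 0 < X := by linarith
  have hint (c : ℝ) (hc : 0 < c) :
      IntegrableOn (fun t : ℝ => charSum χ t * (t : ℂ) ^ (-(s + 1))) (Ioi c) :=
    integrableOn_mul_cpow measurable_charSum hM hc (by simp; linarith)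
  have h1 : χ.LFunction s = s * ∫ t in Ioi (1 : ℝ), charSum χ t * (t : ℂ) ^ (-(s + 1)) := by
    rw [DirichletCharacter.LFunction_eq_LSeries χ hs,
      LSeries_eq_mul_integral (fun n => χ (n : ZMod q)) le_rfl (by linarith)
        (ZMod.LSeriesSummable_of_one_lt_re χ hs)]
    · congr 1
      refine setIntegral_congr_fun measurableSet_Ioi fun t ht => ?_
      rw [charSum_eq_sum_Icc_one hq hχ (by linarith [mem_Ioi.1 ht])]
    · refine Asymptotics.IsBigO.of_bound M (.of_forall fun n => ?_)
      have := hM n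
      rw [charSum_eq_sum_Icc_one hq hχ n.cast_nonneg, Nat.floor_natCast] at this
      simpa using this
  have hd (t : ℝ) (ht : 0 < t) : HasDerivAt (fun t : ℝ => (t : ℂ) ^ (-s))
      (-s * (t : ℂ) ^ (-(s + 1))) t := by
    have h := hasDerivAt_ofReal_cpow_const' (r := -(s + 1)) ht.ne' (by
      intro h; apply hs0; linear_combination -h)
    have h2 := h.const_mul (-s)
    have e : -(s + 1) + 1 = -s := by ring
    simp only [e] at h2
    refine h2.congr_of_eventuallyEq (.of_forall fun t => ?_)
    field_simp
  have hcont : ContinuousOn (deriv fun t : ℝ => (t : ℂ) ^ (-s)) (Icc 1 X) := by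
    have : ContinuousOn (fun t : ℝ => -s * (t : ℂ) ^ (-(s + 1))) (Icc 1 X) := by
      refine ContinuousOn.mul continuousOn_const fun t ht =>
        (Complex.continuousAt_ofReal_cpow_const _ _ (Or.inr ?_)).continuousWithinAt
      linarith [ht.1]
    exact this.congr fun t ht => (hd t (by linarith [ht.1])).deriv
  have h2 := sum_mul_eq_sub_integral_mul₀ (fun n => χ (n : ZMod q)) hχ0 X
    (f := fun t : ℝ => (t : ℂ) ^ (-s)) (fun t ht => (hd t (by linarith [ht.1])).differentiableAt)
    hcont.integrableOn_Icc
  rw [← charSum_eq_sum_Icc_zero hχ hX0.le] at h2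
  have h3 : ∫ t in Ioc 1 X, deriv (fun t : ℝ => (t : ℂ) ^ (-s)) t *
      ∑ k ∈ Finset.Icc 0 ⌊t⌋₊, χ (k : ZMod q) =
      -s * ∫ t in Ioc 1 X, charSum χ t * (t : ℂ) ^ (-(s + 1)) := by
    rw [← integral_const_mul]
    refine setIntegral_congr_fun measurableSet_Ioc fun t ht => ?_
    have ht0 : 0 < t := by linarith [ht.1]
    rw [(hd t ht0).deriv, charSum_eq_sum_Icc_zero hχ ht0.le]
    ring
  have h4 : ∑ n ∈ Finset.Icc 1 ⌊X⌋₊, χ (n : ZMod q) * (n : ℂ) ^ (-s) =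
      ∑ k ∈ Finset.Icc 0 ⌊X⌋₊, ((k : ℝ) : ℂ) ^ (-s) * χ (k : ZMod q) := by
    rw [← Finset.Ioc_insert_left (Nat.zero_le _), Finset.sum_insert (by simp), hχ0, mul_zero,
      zero_add]
    refine Finset.sum_congr rfl fun k _ => ?_
    rw [mul_comm, Complex.ofReal_natCast]
  have h5 : ∫ t in Ioi (1 : ℝ), charSum χ t * (t : ℂ) ^ (-(s + 1)) =
      (∫ t in Ioc 1 X, charSum χ t * (t : ℂ) ^ (-(s + 1))) +
        ∫ t in Ioi X, charSum χ t * (t : ℂ) ^ (-(s + 1)) := by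
    rw [← Ioc_union_Ioi_eq_Ioi hX]
    exact setIntegral_union (Ioc_disjoint_Ioi le_rfl) measurableSet_Ioi
      ((hint 1 one_pos).mono_set Ioc_subset_Ioi_self) (hint X hX0)
  rw [h1, h4, h2, h3, h5]
  ring
end

section
open MeasureTheory Set

variable {q : ℕ} [NeZero q] {χ : DirichletCharacter ℂ q}

lemma natCast_cpow_neg {n : ℕ} (hn : n ≠ 0) (s : ℂ) :
    (n : ℂ) ^ (-s) = cexp (-(Real.log n : ℂ) * s) := by
  rw [Complex.cpow_def_of_ne_zero (Nat.cast_ne_zero.2 hn), Complex.natCast_log]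
  ring_nf

lemma ofReal_cpow_neg {X : ℝ} (hX : 0 < X) (s : ℂ) :
    (X : ℂ) ^ (-s) = cexp (-(Real.log X : ℂ) * s) := by
  rw [Complex.cpow_def_of_ne_zero (by exact_mod_cast hX.ne'), Complex.ofReal_log hX.le]
  ring_nf

lemma exists_norm_LFunction_sub_sum_add_le (hq : 2 ≤ q) (hχ : χ ≠ 1) {M : ℝ}
    (hM : ∀ u, ‖charSum χ u‖ ≤ M) {X : ℝ} (hX : 1 ≤ X) :
    ∃ c : ℂ, ‖c‖ ≤ 2 * M ∧ ∀ s : ℂ, -1 < s.re →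
      ‖χ.LFunction s - ∑ n ∈ Finset.Icc 1 ⌊X⌋₊, χ (n : ZMod q) * cexp (-(Real.log n : ℂ) * s) +
          c * cexp (-(Real.log X : ℂ) * s)‖ ≤
        ‖s‖ * ‖s + 1‖ * (2 * M * q * (X ^ (-s.re - 1) / (s.re + 1))) := by
  have hX0 : 0 < X := by linarith
  have hq0 : (0 : ℝ) < q := by positivity
  have hqC : (q : ℂ) ≠ 0 := NeZero.ne _
  obtain ⟨m, hm⟩ : ∃ m : ℂ, m = (q : ℂ)⁻¹ * ∫ x in (0 : ℝ)..q, charSum χ x := ⟨_, rfl⟩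
  have hint := intervalIntegrable_of_measurable_of_norm_le (measurable_charSum (χ := χ)) hM
  have hmM : ‖m‖ ≤ M := by
    have h := intervalIntegral.norm_integral_le_of_norm_le_const (a := 0) (b := q)
      fun x _ => hM x
    rw [sub_zero, abs_of_pos hq0] at h
    rw [hm, norm_mul, norm_inv, Complex.norm_natCast, inv_mul_le_iff₀ hq0]
    linarith
  obtain ⟨a, ha⟩ : ∃ a : ℝ → ℂ, a = fun u => charSum χ u - m := ⟨_, rfl⟩
  have hau (u : ℝ) : a u = charSum χ u - m := congrFun ha u
  have ham : Measurable a := ha ▸ measurable_charSum.sub_const m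
  have haM (u : ℝ) : ‖a u‖ ≤ 2 * M := by
    rw [hau]
    refine (norm_sub_le _ _).trans ?_
    linarith [hM u]
  have hap : Function.Periodic a q := fun u => by rw [hau, hau, charSum_periodic u]
  have ha0 : ∫ x in (0 : ℝ)..q, a x = 0 := by
    simp only [hau]
    rw [intervalIntegral.integral_sub (hint _ _) intervalIntegrable_const,
      intervalIntegral.integral_const, hm, sub_zero, Complex.real_smul, Complex.ofReal_natCast,
      mul_inv_cancel_left₀ hqC, sub_self]
  have har (x : ℝ) : ContinuousWithinAt a (Ioi x) x :=
    ha ▸ (continuousWithinAt_charSum x).sub continuousWithinAt_const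
  have hBb := norm_integral_le_of_periodic (X := X) ham haM hq0 hap ha0
  have hBc := continuous_integral_of_norm_le (X := X) ham haM
  refine ⟨a X, haM X, fun s hs => ?_⟩
  have hU : IsOpen {s : ℂ | -1 < s.re} := isOpen_lt continuous_const continuous_re
  have hL : Differentiable ℂ fun s => χ.LFunction s -
      ∑ n ∈ Finset.Icc 1 ⌊X⌋₊, χ (n : ZMod q) * cexp (-(Real.log n : ℂ) * s) +
          a X * cexp (-(Real.log X : ℂ) * s) := by
    have := DirichletCharacter.differentiable_LFunction hχ
    fun_prop
  have hR : DifferentiableOn ℂ (fun s => s * (s + 1) *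
      ∫ t in Ioi X, (∫ x in X..t, a x) * (t : ℂ) ^ (-(s + 2))) {s : ℂ | -1 < s.re} := fun s hs =>
    (DifferentiableAt.mul (by fun_prop)
      (differentiableAt_integral_mul_cpow hBc hBb hX0 hs)).differentiableWithinAt
  have hev : ∀ s : ℂ, 1 < s.re → χ.LFunction s -
      ∑ n ∈ Finset.Icc 1 ⌊X⌋₊, χ (n : ZMod q) * cexp (-(Real.log n : ℂ) * s) +
          a X * cexp (-(Real.log X : ℂ) * s) = s * (s + 1) *
      ∫ t in Ioi X, (∫ x in X..t, a x) * (t : ℂ) ^ (-(s + 2)) := by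
    intro s hs
    have hs0 : s ≠ 0 := by rintro rfl; simp at hs; linarith
    have h1 := LFunction_sub_sum_eq hq hχ hM hX hs
    have h2 := integral_mul_cpow_by_parts ham haM hq0 hap ha0 har hX0 (s := s) (by linarith)
    have hre : (-(s + 1)).re < -1 := by simp; linarith
    have h3 : ∫ t in Ioi X, charSum χ t * (t : ℂ) ^ (-(s + 1)) =
        (∫ t in Ioi X, a t * (t : ℂ) ^ (-(s + 1))) + m * ((X : ℂ) ^ (-s) / s) := by
      have h4 := integral_Ioi_cpow_of_lt hre hX0
      rw [show -(s + 1) + 1 = -s by ring, neg_div_neg_eq] at h4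
      rw [← h4, ← integral_const_mul, ← integral_add (integrableOn_mul_cpow ham haM hX0 hre)
        ((integrableOn_Ioi_cpow_of_lt hre hX0).const_mul m)]
      refine setIntegral_congr_fun measurableSet_Ioi fun t _ => ?_
      simp only [hau]
      ring
    have h5 : ∑ n ∈ Finset.Icc 1 ⌊X⌋₊, χ (n : ZMod q) * (n : ℂ) ^ (-s) =
        ∑ n ∈ Finset.Icc 1 ⌊X⌋₊, χ (n : ZMod q) * cexp (-(Real.log n : ℂ) * s) :=
      Finset.sum_congr rfl fun n hn => by
        rw [natCast_cpow_neg (by linarith [(Finset.mem_Icc.1 hn).1])]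
    rw [← h5, h1, h3, h2, ← ofReal_cpow_neg hX0, hau]
    field_simp
    ring
  have heq := AnalyticOnNhd.eqOn_of_preconnected_of_eventuallyEq
    (hL.differentiableOn.analyticOnNhd hU) (hR.analyticOnNhd hU)
    (convex_halfSpace_re_gt (-1)).isPreconnected (z₀ := 2) (by simp; norm_num)
    (by
      filter_upwards [(isOpen_lt continuous_const continuous_re).mem_nhds
        (show (1 : ℝ) < (2 : ℂ).re by simp)] with s hs
      exact hev s hs)
  have h := heq hs
  simp only at h
  rw [h, norm_mul, norm_mul]
  exact mul_le_mul_of_nonneg_left (norm_integral_mul_cpow_le hBb hX0 hs) (by positivity)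

lemma iteratedDeriv_sum_cexp (s : Finset ℕ) (f : ℕ → ℂ) (l : ℕ → ℂ) (r : ℕ) :
    iteratedDeriv r (fun z => ∑ n ∈ s, f n * cexp (l n * z)) 0 = ∑ n ∈ s, f n * l n ^ r := by
  rw [iteratedDeriv_fun_sum fun n _ => by fun_prop]
  refine Finset.sum_congr rfl fun n _ => ?_
  rw [iteratedDeriv_const_mul_field, iteratedDeriv_cexp_const_mul]
  simp

lemma factorial_succ_le (r : ℕ) (hr : 1 ≤ r) : (r + 1).factorial ≤ 2 * r ^ r := by
  induction r, hr using Nat.le_induction with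
  | base => simp
  | succ r hr ih =>
    rw [Nat.factorial_succ]
    have h : 2 * r ^ r ≤ (r + 1) ^ r := by
      obtain ⟨k, rfl⟩ : ∃ k, r = k + 1 := ⟨r - 1, by omega⟩
      have := one_add_mul_le_pow (a := (1 : ℚ) / (k + 1))
        (le_trans (by norm_num) (by positivity : (0 : ℚ) ≤ 1 / (k + 1))) (k + 1)
      have h2 : (2 : ℚ) ≤ (1 + 1 / (k + 1)) ^ (k + 1) := by
        refine le_trans (le_of_eq ?_) this
        push_cast; field_simp; ring
      have h3 : (1 + 1 / ((k : ℚ) + 1)) ^ (k + 1) * (k + 1) ^ (k + 1) = (k + 1 + 1) ^ (k + 1) := by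
        rw [← mul_pow]; congr 1; field_simp
      have h4 : (2 : ℚ) * (k + 1) ^ (k + 1) ≤ (k + 1 + 1) ^ (k + 1) := by
        rw [← h3]; gcongr
      exact_mod_cast h4
    calc (r + 1 + 1) * (r + 1).factorial ≤ (r + 1 + 1) * (2 * r ^ r) := by gcongr
      _ ≤ (2 * (r + 1)) * (r + 1) ^ r := by
          refine Nat.mul_le_mul (by omega) h
      _ = 2 * (r + 1) ^ (r + 1) := by ring

lemma norm_iteratedDeriv_LFunction_sub_le (hq : 3 ≤ q) (hχ : χ ≠ 1) {M : ℝ}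
    (hM : ∀ u, ‖charSum χ u‖ ≤ M) (r : ℕ) (hr : 1 ≤ r) :
    ‖iteratedDeriv r χ.LFunction 0 - (-1) ^ r *
        ∑ n ∈ Finset.Icc 1 ⌊(q : ℝ) * Real.exp ((r : ℝ) - 1)⌋₊,
          χ (n : ZMod q) * (Real.log n : ℂ) ^ r‖ ≤ 26 * M * (Real.log q + r) ^ r := by
  have hq3 : (3 : ℝ) ≤ q := by exact_mod_cast hq
  have hr1 : (1 : ℝ) ≤ r := by exact_mod_cast hr
  have hM0 : 0 ≤ M := (norm_nonneg _).trans (hM 0)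
  have hl : 1 ≤ Real.log q := by
    rw [Real.le_log_iff_exp_le (by linarith)]
    linarith [Real.exp_one_lt_d9]
  obtain ⟨X, hXdef⟩ : ∃ X : ℝ, X = (q : ℝ) * Real.exp ((r : ℝ) - 1) := ⟨_, rfl⟩
  rw [← hXdef]
  have hX : 1 ≤ X := by
    have := Real.one_le_exp (x := (r : ℝ) - 1) (by linarith)
    rw [hXdef]; nlinarith
  have hX0 : 0 < X := by linarith
  have hlogX : Real.log X = Real.log q + (r - 1) := by
    rw [hXdef, Real.log_mul (by linarith) (Real.exp_pos _).ne', Real.log_exp]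
  obtain ⟨c, hc, hbound⟩ := exists_norm_LFunction_sub_sum_add_le (by omega) hχ hM hX
  set D : ℝ := Real.log q + r with hD
  have hD0 : 0 < D := by linarith
  set ρ : ℝ := r / D with hρ
  have hρ0 : 0 < ρ := by positivity
  have hρ1 : ρ < 1 := by rw [hρ, div_lt_one hD0]; linarith
  have hρD : ρ * D = r := div_mul_cancel₀ _ hD0.ne'
  set G : ℂ → ℂ := fun s => χ.LFunction s -
      ∑ n ∈ Finset.Icc 1 ⌊X⌋₊, χ (n : ZMod q) * cexp (-(Real.log n : ℂ) * s) +
          c * cexp (-(Real.log X : ℂ) * s) with hG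
  have hLd := DirichletCharacter.differentiable_LFunction hχ
  have hGd : Differentiable ℂ G := by fun_prop
  have hGr : iteratedDeriv r G 0 = iteratedDeriv r χ.LFunction 0 - (-1) ^ r *
      ∑ n ∈ Finset.Icc 1 ⌊X⌋₊, χ (n : ZMod q) * (Real.log n : ℂ) ^ r +
        c * (-(Real.log X : ℂ)) ^ r := by
    rw [hG, iteratedDeriv_fun_add (ContDiffAt.sub hLd.contDiff.contDiffAt (by fun_prop))
      (by fun_prop), iteratedDeriv_fun_sub hLd.contDiff.contDiffAt (by fun_prop),
      iteratedDeriv_sum_cexp, iteratedDeriv_const_mul_field, iteratedDeriv_cexp_const_mul,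
      Finset.mul_sum]
    congr 1
    · congr 1
      refine Finset.sum_congr rfl fun n _ => ?_
      rw [neg_pow]
      ring
    · simp
  have hsphere : ∀ z ∈ Metric.sphere (0 : ℂ) ρ, ‖G z‖ ≤ 12 * M * (1 + r) := by
    intro z hz
    have hz' : ‖z‖ = ρ := by simpa using hz
    have hzre : -ρ ≤ z.re := by
      have := (abs_le.1 (Complex.abs_re_le_norm z)).1
      rwa [hz'] at this
    refine (hbound z (by linarith)).trans ?_
    have hz1 : ‖z + 1‖ ≤ 2 := by
      refine (norm_add_le _ _).trans ?_
      rw [hz', norm_one]; linarith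
    have hzz : ‖z‖ * ‖z + 1‖ ≤ 2 := by
      have := norm_nonneg (z + 1)
      rw [hz']; nlinarith
    have hXle : q * X ^ (-z.re - 1) ≤ 3 := by
      have h1 : X ^ (-z.re - 1) ≤ X ^ (ρ - 1) :=
        Real.rpow_le_rpow_of_exponent_le hX (by linarith)
      have h2 : (q : ℝ) * X ^ (ρ - 1) = Real.exp (Real.log q + Real.log X * (ρ - 1)) := by
        rw [Real.exp_add, Real.exp_log (by linarith), Real.rpow_def_of_pos hX0]
      have h3 : Real.log q + Real.log X * (ρ - 1) ≤ 1 := by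
        have : Real.log X = D - 1 := by rw [hlogX, hD]; ring
        rw [this]
        nlinarith
      calc (q : ℝ) * X ^ (-z.re - 1) ≤ q * X ^ (ρ - 1) := by gcongr
        _ = Real.exp (Real.log q + Real.log X * (ρ - 1)) := h2
        _ ≤ Real.exp 1 := Real.exp_le_exp.2 h3
        _ ≤ 3 := by linarith [Real.exp_one_lt_d9]
    have hinv : 1 / (z.re + 1) ≤ 1 + r := by
      rw [div_le_iff₀ (by linarith)]
      have h1 : 1 ≤ (1 + (r : ℝ)) * (1 - ρ) := by
        have e : 1 - ρ = Real.log q / D := by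
          rw [hρ, eq_div_iff hD0.ne', sub_mul, div_mul_cancel₀ _ hD0.ne', hD]; ring
        rw [e, ← mul_div_assoc, one_le_div hD0, hD]
        nlinarith
      nlinarith
    have hre0 : 0 < z.re + 1 := by linarith
    have hXp : 0 ≤ X ^ (-z.re - 1) := Real.rpow_nonneg hX0.le _
    calc ‖z‖ * ‖z + 1‖ * (2 * M * q * (X ^ (-z.re - 1) / (z.re + 1)))
        = (‖z‖ * ‖z + 1‖) * (2 * M * ((q * X ^ (-z.re - 1)) * (1 / (z.re + 1)))) := by ring
      _ ≤ 2 * (2 * M * (3 * (1 + r))) := by gcongr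
      _ = 12 * M * (1 + r) := by ring
  have hcauchy := Complex.norm_iteratedDeriv_le_of_forall_mem_sphere_norm_le r hρ0
    hGd.diffContOnCl hsphere
  have hfac : (r.factorial : ℝ) * (12 * M * (1 + r)) / ρ ^ r ≤ 24 * M * D ^ r := by
    rw [div_le_iff₀ (by positivity), mul_assoc (24 * M), ← mul_pow, mul_comm D ρ, hρD]
    have h : (((r + 1).factorial : ℕ) : ℝ) ≤ 2 * (r : ℝ) ^ r := by
      exact_mod_cast factorial_succ_le r hr
    rw [Nat.factorial_succ] at h
    push_cast at h
    nlinarith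
  have hlast : ‖c * (-(Real.log X : ℂ)) ^ r‖ ≤ 2 * M * D ^ r := by
    rw [norm_mul, norm_pow, norm_neg, Complex.norm_real, Real.norm_eq_abs,
      abs_of_nonneg (Real.log_nonneg hX)]
    have : Real.log X ≤ D := by rw [hlogX, hD]; linarith
    have := Real.log_nonneg hX
    gcongr
  have hfin : iteratedDeriv r χ.LFunction 0 - (-1) ^ r *
      ∑ n ∈ Finset.Icc 1 ⌊X⌋₊, χ (n : ZMod q) * (Real.log n : ℂ) ^ r =
      iteratedDeriv r G 0 - c * (-(Real.log X : ℂ)) ^ r := by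
    rw [hGr]; ring
  rw [hfin]
  refine (norm_sub_le _ _).trans ?_
  linarith
end

/-- there is an absolute constant such that for every primitive Dirichlet
character `χ` mod `q ≥ 3` and every `r ≥ 1`,
`L^{(r)}(0,χ) = (-1)^r ∑_{n ≤ q·e^{r-1}} χ(n)(log n)^r + O(q^{1/2} log q (log q + r)^r)`. -/
theorem stmt14 : ∃ C : ℝ, 0 < C ∧ ∀ (q : ℕ) [NeZero q], 3 ≤ q →
    ∀ (χ : DirichletCharacter ℂ q), χ.IsPrimitive → ∀ r : ℕ, 1 ≤ r →
    ‖iteratedDeriv r (DirichletCharacter.LFunction χ) 0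
        - (-1) ^ r * ∑ n ∈ Finset.Icc 1 ⌊(q : ℝ) * Real.exp ((r : ℝ) - 1)⌋₊,
            χ (n : ZMod q) * (Real.log n : ℂ) ^ r‖ ≤
      C * (q : ℝ) ^ ((1 : ℝ) / 2) * Real.log q * (Real.log q + r) ^ r := by
  refine ⟨52, by norm_num, fun q _ hq χ hχ r hr => ?_⟩
  have hq3 : (3 : ℝ) ≤ q := by exact_mod_cast hq
  have hl : 1 ≤ Real.log q := by
    rw [Real.le_log_iff_exp_le (by linarith)]
    linarith [Real.exp_one_lt_d9]
  refine (norm_iteratedDeriv_LFunction_sub_le hq (ne_one_of_isPrimitive (by omega) hχ)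
    (fun u => norm_sum_range_le_of_isPrimitive (by omega) hχ _) r hr).trans ?_
  rw [← Real.sqrt_eq_rpow]
  have hD : 0 ≤ (Real.log q + r) ^ r := by positivity
  refine mul_le_mul_of_nonneg_right ?_ hD
  nlinarith [Real.sqrt_nonneg (q : ℝ)]
end
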